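/- Let V, λ, u be as in the Fermi-coordinate setup. Then for every y₀ ∈ ℝ with u_y(0,y₀) = 0 and u_{yy}(0,y₀) = 0 one has (1/2)·∂_x[u_x² + λ^{−2}·u_y²](0,y₀) = −λ_x(0,y₀)·u_x(0,y₀)²; equivalently, if in addition u_x(0,y₀) ≠ 0, then −(1/2)·∂_x[log(u_x² + λ^{−2}·u_y²)](0,y₀) = −κ(y₀), where κ(y₀) = −λ_x(0,y₀). -/

import Mathlib

/-- Partial derivative of `f : ℝ² → ℝ` with respect to the first coordinate. -/
noncomputable def pderiv1 (f : ℝ × ℝ → ℝ) (p : ℝ × ℝ) : ℝ :=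
  deriv (fun x : ℝ => f (x, p.2)) p.1

/-- Partial derivative of `f : ℝ² → ℝ` with respect to the second coordinate. -/
noncomputable def pderiv2 (f : ℝ × ℝ → ℝ) (p : ℝ × ℝ) : ℝ :=
  deriv (fun y : ℝ => f (p.1, y)) p.2

theorem DifferentiableAt.hasDerivAt_pderiv1 {f : ℝ × ℝ → ℝ} {p : ℝ × ℝ}
    (hf : DifferentiableAt ℝ f p) :
    HasDerivAt (fun x : ℝ => f (x, p.2)) (pderiv1 f p) p.1 :=
  (hf.comp p.1 (differentiableAt_id.prodMk (differentiableAt_const p.2))).hasDerivAt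

theorem DifferentiableAt.pderiv1_eq_fderiv {f : ℝ × ℝ → ℝ} {p : ℝ × ℝ}
    (hf : DifferentiableAt ℝ f p) : pderiv1 f p = fderiv ℝ f p (1, 0) :=
  (hf.hasFDerivAt.comp_hasDerivAt p.1
    ((hasDerivAt_id p.1).prodMk (hasDerivAt_const p.1 p.2))).deriv

theorem DifferentiableAt.pderiv2_eq_fderiv {f : ℝ × ℝ → ℝ} {p : ℝ × ℝ}
    (hf : DifferentiableAt ℝ f p) : pderiv2 f p = fderiv ℝ f p (0, 1) :=
  (hf.hasFDerivAt.comp_hasDerivAt p.2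
    ((hasDerivAt_const p.2 p.1).prodMk (hasDerivAt_id p.2))).deriv

theorem ContDiffAt.differentiableAt_fderiv_apply {f : ℝ × ℝ → ℝ} {p : ℝ × ℝ}
    (hf : ContDiffAt ℝ 2 f p) (v : ℝ × ℝ) :
    DifferentiableAt ℝ (fun q => fderiv ℝ f q v) p :=
  ((hf.fderiv_right (m := 1) (by norm_num)).differentiableAt one_ne_zero).clm_apply
    (differentiableAt_const v)

theorem ContDiffAt.eventually_differentiableAt {f : ℝ × ℝ → ℝ} {p : ℝ × ℝ}
    (hf : ContDiffAt ℝ 2 f p) : ∀ᶠ q in nhds p, DifferentiableAt ℝ f q :=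
  (hf.eventually (by simp)).mono fun _ h => h.differentiableAt two_ne_zero

theorem ContDiffAt.differentiableAt_pderiv1 {f : ℝ × ℝ → ℝ} {p : ℝ × ℝ}
    (hf : ContDiffAt ℝ 2 f p) : DifferentiableAt ℝ (pderiv1 f) p :=
  (hf.differentiableAt_fderiv_apply (1, 0)).congr_of_eventuallyEq
    (hf.eventually_differentiableAt.mono fun _ h => h.pderiv1_eq_fderiv)

theorem ContDiffAt.differentiableAt_pderiv2 {f : ℝ × ℝ → ℝ} {p : ℝ × ℝ}
    (hf : ContDiffAt ℝ 2 f p) : DifferentiableAt ℝ (pderiv2 f) p :=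
  (hf.differentiableAt_fderiv_apply (0, 1)).congr_of_eventuallyEq
    (hf.eventually_differentiableAt.mono fun _ h => h.pderiv2_eq_fderiv)

/-- Fermi-coordinate computation behind Claim 3: at a boundary point where
`u_y(0,y₀) = 0` and `u_{yy}(0,y₀) = 0`, one has
`(1/2)·∂_x[u_x² + λ⁻²·u_y²](0,y₀) = −λ_x(0,y₀)·u_x(0,y₀)²`;
equivalently, if in addition `u_x(0,y₀) ≠ 0`, then
`−(1/2)·∂_x[log(u_x² + λ⁻²·u_y²)](0,y₀) = −κ(y₀)` with `κ(y₀) = −λ_x(0,y₀)`. -/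
theorem fermi_boundary_identity_claim3
    (V : Set (ℝ × ℝ)) (hV : IsOpen V) (hV0 : ∀ y : ℝ, ((0 : ℝ), y) ∈ V)
    (lam : ℝ × ℝ → ℝ) (hlam : ContDiffOn ℝ (⊤ : ℕ∞) lam V)
    (hlampos : ∀ p ∈ V, 0 < lam p) (hlam1 : ∀ y : ℝ, lam (0, y) = 1)
    (u : ℝ × ℝ → ℝ) (hu : ContDiffOn ℝ (⊤ : ℕ∞) u V)
    (hharm : ∀ p ∈ V,
      pderiv1 (pderiv1 u) p + ((lam p) ^ 2)⁻¹ * pderiv2 (pderiv2 u) p +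
        (pderiv1 lam p / lam p) * pderiv1 u p -
        (pderiv2 lam p / (lam p) ^ 3) * pderiv2 u p = 0) :
    ∀ y₀ : ℝ, pderiv2 u (0, y₀) = 0 → pderiv2 (pderiv2 u) (0, y₀) = 0 →
      (1 / 2) * pderiv1
          (fun p => (pderiv1 u p) ^ 2 + ((lam p) ^ 2)⁻¹ * (pderiv2 u p) ^ 2) (0, y₀)
        = -(pderiv1 lam (0, y₀)) * (pderiv1 u (0, y₀)) ^ 2 ∧
      (pderiv1 u (0, y₀) ≠ 0 →
        -(1 / 2) * pderiv1
            (fun p => Real.log ((pderiv1 u p) ^ 2 + ((lam p) ^ 2)⁻¹ * (pderiv2 u p) ^ 2))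
            (0, y₀)
          = -(-(pderiv1 lam (0, y₀)))) := by
  intro y₀ hy hyy
  have hnhds : V ∈ nhds ((0 : ℝ), y₀) := hV.mem_nhds (hV0 y₀)
  have hle : (2 : WithTop ℕ∞) ≤ ((⊤ : ℕ∞) : WithTop ℕ∞) := WithTop.coe_le_coe.2 (le_top : (2 : ℕ∞) ≤ ⊤)
  have hu2 : ContDiffAt ℝ 2 u (0, y₀) := (hu.contDiffAt hnhds).of_le hle
  have hl2 : ContDiffAt ℝ 2 lam (0, y₀) := (hlam.contDiffAt hnhds).of_le hle
  have hux := hu2.differentiableAt_pderiv1.hasDerivAt_pderiv1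
  have huy := hu2.differentiableAt_pderiv2.hasDerivAt_pderiv1
  have hlx := (hl2.differentiableAt two_ne_zero).hasDerivAt_pderiv1
  have huxx : pderiv1 (pderiv1 u) (0, y₀) = -(pderiv1 lam (0, y₀)) * pderiv1 u (0, y₀) := by
    have h := hharm (0, y₀) (hV0 y₀)
    rw [hy, hyy, hlam1] at h
    linarith
  have hgrad : HasDerivAt
      (fun x : ℝ => (pderiv1 u (x, y₀)) ^ 2 + ((lam (x, y₀)) ^ 2)⁻¹ * (pderiv2 u (x, y₀)) ^ 2)
      (-2 * pderiv1 lam (0, y₀) * pderiv1 u (0, y₀) ^ 2) 0 := by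
    have hl0 : lam (0, y₀) ^ 2 ≠ 0 := by simp [hlam1]
    refine ((hux.pow 2).add (((hlx.pow 2).inv hl0).mul (huy.pow 2))).congr_deriv ?_
    simp [hy, huxx]
    ring
  refine ⟨?_, fun hne => ?_⟩
  · rw [pderiv1, hgrad.deriv]
    ring
  · rw [pderiv1, (hgrad.log (by simpa [hy] using hne)).deriv, hy]
    field_simp
    ring
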